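/- arXiv:2510.13406 — 5 statements merged into one kernel-verified Lean document; each statement's English description precedes it below -/
import Mathlib

section
/- Let D and N be positive integers and let X, Y be real D×N matrices such that ‖XᵀX − YᵀY‖_F ≤ ε for some ε ≥ 0, where ‖·‖_F denotes the Frobenius norm. Then there exists a D×D orthogonal matrix Q (i.e., QᵀQ = I) such that ‖QX − Y‖_F ≤ (2D)^{1/4} · √ε. -/
open Matrix

/-- The Frobenius norm of a real matrix: `‖A‖_F = (Σ_{i,j} A_{ij}²)^{1/2}`. -/
noncomputable def frobNorm {m n : Type*} [Fintype m] [Fintype n] (A : Matrix m n ℝ) : ℝ :=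
  Real.sqrt (∑ i, ∑ j, (A i j) ^ 2)

theorem frobNorm_sq {m n : Type*} [Fintype m] [Fintype n] (A : Matrix m n ℝ) :
    frobNorm A ^ 2 = trace (A * Aᵀ) := by
  rw [frobNorm, Real.sq_sqrt (by positivity)]
  simp [trace, Matrix.mul_apply, sq]

theorem trace_mul_transpose_self_nonneg {m n : Type*} [Fintype m] [Fintype n]
    (A : Matrix m n ℝ) : 0 ≤ trace (A * Aᵀ) := by
  rw [← frobNorm_sq]
  positivity

theorem isCompact_setOf_transpose_mul_self_eq_one {n : Type*} [Fintype n] [DecidableEq n] :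
    IsCompact {Q : Matrix n n ℝ | Qᵀ * Q = 1} := by
  have hbox : IsCompact (Set.univ.pi fun _ : n => Set.univ.pi fun _ : n => Set.Icc (-1 : ℝ) 1) :=
    isCompact_univ_pi fun _ => isCompact_univ_pi fun _ => isCompact_Icc
  refine hbox.of_isClosed_subset (isClosed_eq (by fun_prop) continuous_const) ?_
  intro (Q : Matrix n n ℝ) hQ i _ j _
  have hjj : ∑ k, Q k j ^ 2 = 1 := by
    have hQ' : Qᵀ * Q = 1 := hQ
    have h := congrFun (congrFun hQ' j) j
    rw [Matrix.mul_apply, one_apply_eq] at h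
    simpa [sq] using h
  have hij : Q i j ^ 2 ≤ 1 :=
    hjj ▸ Finset.single_le_sum (f := fun k => Q k j ^ 2) (fun k _ => sq_nonneg _)
      (Finset.mem_univ i)
  exact abs_le.mp ((sq_le_one_iff_abs_le_one _).mp hij)

/-- The reflection in the hyperplane orthogonal to `v` (the identity if `v = 0`). -/
noncomputable def reflectionMatrix {n : Type*} [Fintype n] [DecidableEq n] (v : n → ℝ) :
    Matrix n n ℝ :=
  1 - (2 / (v ⬝ᵥ v)) • vecMulVec v v

theorem reflectionMatrix_transpose_mul_self {n : Type*} [Fintype n] [DecidableEq n]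
    (v : n → ℝ) : (reflectionMatrix v)ᵀ * reflectionMatrix v = 1 := by
  by_cases hv : v ⬝ᵥ v = 0
  · simp [reflectionMatrix, hv]
  · have ht : (reflectionMatrix v)ᵀ = reflectionMatrix v := by
      simp [reflectionMatrix, transpose_vecMulVec]
    rw [ht, reflectionMatrix]
    simp only [sub_mul, mul_sub, one_mul, mul_one, smul_mul_assoc, mul_smul_comm,
      vecMulVec_mul_vecMulVec, smul_smul, vecMulVec_smul]
    have hc : 2 / (v ⬝ᵥ v) * (v ⬝ᵥ v) = 2 := by
      field_simp
    rw [hc]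
    module

theorem trace_reflectionMatrix_mul {n : Type*} [Fintype n] [DecidableEq n]
    (v : n → ℝ) (P : Matrix n n ℝ) :
    trace (reflectionMatrix v * P) = trace P - 2 / (v ⬝ᵥ v) * (v ⬝ᵥ P *ᵥ v) := by
  rw [reflectionMatrix, sub_mul, one_mul, trace_sub, smul_mul_assoc, trace_smul,
    vecMulVec_mul, trace_vecMulVec, smul_eq_mul, dotProduct_mulVec, dotProduct_comm (v ᵥ* P)]

/-- A matrix whose trace cannot be increased by an orthogonal factor has a nonnegative
quadratic form. -/
theorem dotProduct_mulVec_nonneg_of_trace_max {n : Type*} [Fintype n] [DecidableEq n]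
    {P : Matrix n n ℝ} (hP : ∀ R : Matrix n n ℝ, Rᵀ * R = 1 → trace (R * P) ≤ trace P)
    (v : n → ℝ) : 0 ≤ v ⬝ᵥ P *ᵥ v := by
  by_cases hv : v = 0
  · simp [hv]
  · have hpos : 0 < v ⬝ᵥ v := by simpa using dotProduct_star_self_pos_iff.mpr hv
    have h := hP _ (reflectionMatrix_transpose_mul_self v)
    rw [trace_reflectionMatrix_mul] at h
    have h' : 0 ≤ 2 / (v ⬝ᵥ v) * (v ⬝ᵥ P *ᵥ v) := by linarith
    exact nonneg_of_mul_nonneg_right h' (by positivity)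

theorem two_mul_dotProduct_mul_le_of_trace_max {n : Type*} [Fintype n] [DecidableEq n]
    {P : Matrix n n ℝ} (hP : ∀ R : Matrix n n ℝ, Rᵀ * R = 1 → trace (R * P) ≤ trace P)
    {u v : n → ℝ} (hu : u ≠ 0) (hv : v ≠ 0) :
    2 * (u ⬝ᵥ v) * (v ⬝ᵥ P *ᵥ u) ≤
      (v ⬝ᵥ v) * (u ⬝ᵥ P *ᵥ u) + (u ⬝ᵥ u) * (v ⬝ᵥ P *ᵥ v) := by
  have hu' : 0 < u ⬝ᵥ u := by simpa using dotProduct_star_self_pos_iff.mpr hu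
  have hv' : 0 < v ⬝ᵥ v := by simpa using dotProduct_star_self_pos_iff.mpr hv
  have hR : (reflectionMatrix u * reflectionMatrix v)ᵀ *
      (reflectionMatrix u * reflectionMatrix v) = 1 := by
    rw [transpose_mul, Matrix.mul_assoc, ← Matrix.mul_assoc (reflectionMatrix u)ᵀ,
      reflectionMatrix_transpose_mul_self, Matrix.one_mul, reflectionMatrix_transpose_mul_self]
  have h := hP _ hR
  have hcross : u ⬝ᵥ (reflectionMatrix v * P) *ᵥ u =
      u ⬝ᵥ P *ᵥ u - 2 / (v ⬝ᵥ v) * ((u ⬝ᵥ v) * (v ⬝ᵥ P *ᵥ u)) := by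
    rw [← mulVec_mulVec, reflectionMatrix, sub_mulVec, one_mulVec, dotProduct_sub,
      smul_mulVec, dotProduct_smul, vecMulVec_mulVec, smul_eq_mul]
    rw [op_smul_eq_smul, dotProduct_smul, smul_eq_mul]
    ring
  rw [Matrix.mul_assoc, trace_reflectionMatrix_mul, trace_reflectionMatrix_mul, hcross] at h
  have key : 2 / ((u ⬝ᵥ u) * (v ⬝ᵥ v)) * (2 * (u ⬝ᵥ v) * (v ⬝ᵥ P *ᵥ u)) ≤
      2 / ((u ⬝ᵥ u) * (v ⬝ᵥ v)) *
        ((v ⬝ᵥ v) * (u ⬝ᵥ P *ᵥ u) + (u ⬝ᵥ u) * (v ⬝ᵥ P *ᵥ v)) := by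
    have e₁ : 2 / ((u ⬝ᵥ u) * (v ⬝ᵥ v)) *
        ((v ⬝ᵥ v) * (u ⬝ᵥ P *ᵥ u) + (u ⬝ᵥ u) * (v ⬝ᵥ P *ᵥ v)) =
        2 / (u ⬝ᵥ u) * (u ⬝ᵥ P *ᵥ u) + 2 / (v ⬝ᵥ v) * (v ⬝ᵥ P *ᵥ v) := by
      field_simp
    have e₂ : 2 / ((u ⬝ᵥ u) * (v ⬝ᵥ v)) * (2 * (u ⬝ᵥ v) * (v ⬝ᵥ P *ᵥ u)) =
        2 / (u ⬝ᵥ u) * (2 / (v ⬝ᵥ v) * ((u ⬝ᵥ v) * (v ⬝ᵥ P *ᵥ u))) := by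
      field_simp
    rw [e₁, e₂]
    linarith
  exact le_of_mul_le_mul_left key (by positivity)

/-- A matrix whose trace cannot be increased by an orthogonal factor is symmetric. -/
theorem transpose_eq_self_of_trace_max {n : Type*} [Fintype n] [DecidableEq n]
    {P : Matrix n n ℝ} (hP : ∀ R : Matrix n n ℝ, Rᵀ * R = 1 → trace (R * P) ≤ trace P) :
    Pᵀ = P := by
  ext i j
  rw [transpose_apply]
  by_cases hij : i = j
  · rw [hij]
  have hle : ∀ t : ℝ, t * (P j i - P i j) ≤ t ^ 2 * (P i i + P j j) := by
    intro t
    have hu : (Pi.single i 1 : n → ℝ) ≠ 0 := by simp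
    have hv : (Pi.single i 1 + t • Pi.single j 1 : n → ℝ) ≠ 0 := by
      intro h0
      simpa [hij] using congrFun h0 i
    have h := two_mul_dotProduct_mul_le_of_trace_max hP hu hv
    simp [mulVec_add, mulVec_smul, hij, Ne.symm hij] at h
    nlinarith
  have hc : 0 ≤ P i i + P j j := by
    have h₁ := hle 1
    have h₂ := hle (-1)
    linarith
  have h := hle ((P j i - P i j) / (P i i + P j j + 1))
  have e₁ : (P j i - P i j) / (P i i + P j j + 1) * (P j i - P i j) =
      ((P j i - P i j) / (P i i + P j j + 1)) ^ 2 * (P i i + P j j + 1) := by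
    field_simp
  rw [e₁] at h
  have hz : ((P j i - P i j) / (P i i + P j j + 1)) ^ 2 = 0 :=
    le_antisymm (by linarith) (sq_nonneg _)
  have hd : P i i + P j j + 1 ≠ 0 := by positivity
  have := (div_eq_zero_iff.mp (pow_eq_zero_iff two_ne_zero |>.mp hz)).resolve_right hd
  linarith

/-- Polar decomposition: every real square matrix becomes symmetric positive semidefinite
after multiplication by a suitable orthogonal matrix. -/
theorem exists_orthogonal_mul_symm_nonneg {n : Type*} [Fintype n] [DecidableEq n]
    (M : Matrix n n ℝ) :
    ∃ Q : Matrix n n ℝ, Qᵀ * Q = 1 ∧ (Q * M)ᵀ = Q * M ∧ ∀ v, 0 ≤ v ⬝ᵥ (Q * M) *ᵥ v := by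
  obtain ⟨Q, hQ, hmax⟩ := isCompact_setOf_transpose_mul_self_eq_one (n := n).exists_isMaxOn
    ⟨1, by simp⟩ (f := fun Q => trace (Q * M)) (by fun_prop)
  have hQ' : Qᵀ * Q = 1 := hQ
  have hP : ∀ R : Matrix n n ℝ, Rᵀ * R = 1 → trace (R * (Q * M)) ≤ trace (Q * M) := by
    intro R hR
    rw [← Matrix.mul_assoc]
    refine hmax (?_ : (R * Q)ᵀ * (R * Q) = 1)
    rw [transpose_mul, Matrix.mul_assoc, ← Matrix.mul_assoc Rᵀ, hR, Matrix.one_mul, hQ']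
  exact ⟨Q, hQ', transpose_eq_self_of_trace_max hP, dotProduct_mulVec_nonneg_of_trace_max hP⟩

theorem trace_mul_mul_transpose_nonneg {m n : Type*} [Fintype m] [Fintype n]
    {P : Matrix m m ℝ} (hP : ∀ v, 0 ≤ v ⬝ᵥ P *ᵥ v) (A : Matrix m n ℝ) :
    0 ≤ trace (P * (A * Aᵀ)) := by
  rw [← Matrix.mul_assoc, trace_mul_comm]
  refine Finset.sum_nonneg fun k _ => ?_
  exact hP (fun i => A i k)

theorem sq_trace_le_card_mul_trace {n : Type*} [Fintype n] (A : Matrix n n ℝ) :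
    trace A ^ 2 ≤ Fintype.card n * trace (A * Aᵀ) := by
  have h₁ : trace A ^ 2 ≤ Fintype.card n * ∑ i, A i i ^ 2 :=
    sq_sum_le_card_mul_sum_sq (s := Finset.univ) (f := fun i => A i i)
  refine h₁.trans (mul_le_mul_of_nonneg_left ?_ (Nat.cast_nonneg _))
  refine Finset.sum_le_sum fun i _ => ?_
  rw [diag_apply, Matrix.mul_apply]
  simp only [transpose_apply, ← sq]
  exact Finset.single_le_sum (f := fun j => A i j ^ 2) (fun j _ => sq_nonneg _)
    (Finset.mem_univ i)

/-- If `X * Yᵀ` is symmetric positive semidefinite, the distance between `X` and `Y` is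
controlled by the distance between their Gram matrices. -/
theorem frobNorm_sub_pow_four_le {m n : Type*} [Fintype m] [Fintype n] {X Y : Matrix m n ℝ}
    (hsymm : (X * Yᵀ)ᵀ = X * Yᵀ) (hnonneg : ∀ v, 0 ≤ v ⬝ᵥ (X * Yᵀ) *ᵥ v) :
    frobNorm (X - Y) ^ 4 ≤ 2 * Fintype.card m * frobNorm (Xᵀ * X - Yᵀ * Y) ^ 2 := by
  obtain ⟨A, hA⟩ : ∃ A, A = X - Y := ⟨_, rfl⟩
  obtain ⟨S, hS⟩ : ∃ S, S = X + Y := ⟨_, rfl⟩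
  have hYX : Y * Xᵀ = X * Yᵀ := by simpa using hsymm
  have hC : (S * Aᵀ)ᵀ = S * Aᵀ := by
    rw [hA, hS]
    simp only [transpose_mul, transpose_sub, transpose_add, transpose_transpose,
      Matrix.mul_sub, Matrix.add_mul, hYX]
  have hSS : S * Sᵀ = A * Aᵀ + (4 : ℝ) • (X * Yᵀ) := by
    rw [hA, hS]
    simp only [transpose_sub, transpose_add,
      Matrix.mul_sub, Matrix.sub_mul, Matrix.mul_add, Matrix.add_mul, hYX]
    module
  have hE : (2 : ℝ) • (Xᵀ * X - Yᵀ * Y) = Aᵀ * S + Sᵀ * A := by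
    rw [hA, hS]
    simp only [transpose_sub, transpose_add,
      Matrix.mul_sub, Matrix.sub_mul, Matrix.mul_add, Matrix.add_mul]
    module
  have hAS : A * Sᵀ = S * Aᵀ := by simpa using hC
  have hE4 : 4 * frobNorm (Xᵀ * X - Yᵀ * Y) ^ 2 =
      2 * trace (S * Aᵀ * (S * Aᵀ)ᵀ) + 2 * trace (S * Sᵀ * (A * Aᵀ)) := by
    have e : 4 * frobNorm (Xᵀ * X - Yᵀ * Y) ^ 2 =
        trace (((2 : ℝ) • (Xᵀ * X - Yᵀ * Y)) * ((2 : ℝ) • (Xᵀ * X - Yᵀ * Y))ᵀ) := by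
      rw [frobNorm_sq, transpose_smul, smul_mul_smul_comm, trace_smul, smul_eq_mul]
      norm_num
    have t₁ : trace (Aᵀ * S * (Aᵀ * S)) = trace (S * Aᵀ * (S * Aᵀ)) := by
      rw [Matrix.mul_assoc, trace_mul_comm]
      simp only [Matrix.mul_assoc]
    have t₂ : trace (Aᵀ * S * (Sᵀ * A)) = trace (S * Sᵀ * (A * Aᵀ)) := by
      rw [Matrix.mul_assoc, trace_mul_comm]
      simp only [Matrix.mul_assoc]
    have t₃ : trace (Sᵀ * A * (Aᵀ * S)) = trace (S * Sᵀ * (A * Aᵀ)) := by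
      rw [trace_mul_comm, t₂]
    have t₄ : trace (Sᵀ * A * (Sᵀ * A)) = trace (S * Aᵀ * (S * Aᵀ)) := by
      rw [Matrix.mul_assoc, trace_mul_comm, Matrix.mul_assoc, Matrix.mul_assoc, hAS,
        ← Matrix.mul_assoc A, hAS]
    rw [e, hE, hC, transpose_add, transpose_mul, transpose_mul, transpose_transpose,
      transpose_transpose]
    simp only [Matrix.mul_add, Matrix.add_mul, trace_add, t₁, t₂, t₃, t₄]
    ring
  have hpos := trace_mul_transpose_self_nonneg (S * Aᵀ)
  have hpos' := trace_mul_mul_transpose_nonneg hnonneg A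
  rw [hSS, Matrix.add_mul, trace_add, smul_mul_assoc, trace_smul, smul_eq_mul] at hE4
  have hcs := sq_trace_le_card_mul_trace (A * Aᵀ)
  rw [transpose_mul, transpose_transpose, ← frobNorm_sq A] at hcs
  rw [← hA]
  have hle : trace (A * Aᵀ * (A * Aᵀ)) ≤ 2 * frobNorm (Xᵀ * X - Yᵀ * Y) ^ 2 := by linarith
  calc frobNorm A ^ 4 = (frobNorm A ^ 2) ^ 2 := by ring
    _ ≤ Fintype.card m * (2 * frobNorm (Xᵀ * X - Yᵀ * Y) ^ 2) :=
      hcs.trans (mul_le_mul_of_nonneg_left hle (Nat.cast_nonneg _))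
    _ = 2 * Fintype.card m * frobNorm (Xᵀ * X - Yᵀ * Y) ^ 2 := by ring

/-- **Main theorem.** If `‖XᵀX − YᵀY‖_F ≤ ε`, then there exists an orthogonal `D × D`
matrix `Q` such that `‖QX − Y‖_F ≤ (2D)^{1/4} √ε`. -/
theorem procrustes_upper_bound (D N : ℕ) (hD : 0 < D) (hN : 0 < N)
    (X Y : Matrix (Fin D) (Fin N) ℝ) (ε : ℝ) (hε : 0 ≤ ε)
    (h : frobNorm (Xᵀ * X - Yᵀ * Y) ≤ ε) :
    ∃ Q : Matrix (Fin D) (Fin D) ℝ, Qᵀ * Q = 1 ∧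
      frobNorm (Q * X - Y) ≤ ((2 * D : ℝ)) ^ ((1 : ℝ) / 4) * Real.sqrt ε := by
  obtain ⟨Q, hQ, hsymm, hnonneg⟩ := exists_orthogonal_mul_symm_nonneg (X * Yᵀ)
  refine ⟨Q, hQ, ?_⟩
  rw [← Matrix.mul_assoc] at hsymm hnonneg
  have hgram : (Q * X)ᵀ * (Q * X) = Xᵀ * X := by
    rw [transpose_mul, Matrix.mul_assoc, ← Matrix.mul_assoc Qᵀ, hQ, Matrix.one_mul]
  have hmain := frobNorm_sub_pow_four_le hsymm hnonneg
  rw [hgram, Fintype.card_fin] at hmain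
  have h0 : 0 ≤ frobNorm (Xᵀ * X - Yᵀ * Y) := Real.sqrt_nonneg _
  refine le_of_pow_le_pow_left₀ four_ne_zero (by positivity) (hmain.trans ?_)
  have hroot : ((2 * D : ℝ) ^ ((1 : ℝ) / 4)) ^ 4 = 2 * D := by
    rw [← Real.rpow_natCast, ← Real.rpow_mul (by positivity)]
    norm_num
  have hsqrt : Real.sqrt ε ^ 4 = ε ^ 2 := by
    rw [show 4 = 2 * 2 from rfl, pow_mul, Real.sq_sqrt hε]
  rw [mul_pow, hroot, hsqrt]
  gcongr
end

section
/- Let D and N be positive integers and let X, Y be real D×N matrices with columns x₁,…,x_N and y₁,…,y_N. Assume that (1/N²) · Σ_{i=1}^N Σ_{j=1}^N (xᵢᵀxⱼ − yᵢᵀyⱼ)² ≤ δ² for some δ ≥ 0. Then there exists a D×D orthogonal matrix Q such that (1/N) · Σ_{i=1}^N ‖Q xᵢ − yᵢ‖² ≤ √(2D) · δ, where ‖·‖ is the Euclidean norm on ℝ^D. -/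
open Matrix

section

variable {m n : Type*} [Fintype m] [Fintype n]

theorem reflectionMatrix_mem_orthogonalGroup [DecidableEq n] {v : n → ℝ} (hv : v ≠ 0) :
    reflectionMatrix v ∈ orthogonalGroup n ℝ := by
  have hvv : v ⬝ᵥ v ≠ 0 := by simpa [dotProduct_self_eq_zero] using hv
  have hT : (reflectionMatrix v)ᵀ = reflectionMatrix v := by
    simp [reflectionMatrix, transpose_vecMulVec]
  rw [mem_orthogonalGroup_iff, hT, reflectionMatrix]
  simp only [sub_mul, mul_sub, one_mul, mul_one, smul_mul_assoc, mul_smul_comm,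
    vecMulVec_mul_vecMulVec, smul_smul, vecMulVec_smul]
  match_scalars <;> field_simp
  ring

theorem trace_vecMulVec_mul (u v : n → ℝ) (S : Matrix n n ℝ) :
    (vecMulVec u v * S).trace = v ⬝ᵥ S *ᵥ u := by
  rw [vecMulVec_mul, trace_vecMulVec, dotProduct_comm, dotProduct_mulVec]

theorem eq_zero_of_forall_mul_le_mul_sq {a b : ℝ} (h : ∀ t : ℝ, t * a ≤ t ^ 2 * b) : a = 0 := by
  have hb : 0 ≤ b := by linarith [h 1, h (-1)]
  have ht := h (a / (b + 1))
  have hb' : 0 < b + 1 := by linarith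
  field_simp at ht
  nlinarith [sq_nonneg a]

theorem posSemidef_of_forall_trace_mul_le [DecidableEq n] {S : Matrix n n ℝ}
    (h : ∀ R ∈ orthogonalGroup n ℝ, (R * S).trace ≤ S.trace) : S.PosSemidef := by
  refine PosSemidef.of_dotProduct_mulVec_nonneg ?_ fun v ↦ ?_
  · ext i j
    simp only [conjTranspose_apply, star_trivial]
    rcases eq_or_ne i j with rfl | hij
    · rfl
    refine sub_eq_zero.1 (eq_zero_of_forall_mul_le_mul_sq (b := S i i + S j j) fun t ↦ ?_)
    set u : n → ℝ := Pi.single i 1 with hu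
    set w : n → ℝ := Pi.single i 1 + t • Pi.single j 1 with hw
    have hu0 : u ≠ 0 := by simp [hu]
    have hw0 : w ≠ 0 := fun h0 ↦ by simpa [hw, hij] using congrFun h0 i
    have huu : u ⬝ᵥ u = 1 := by simp [hu]
    have huw : u ⬝ᵥ w = 1 := by simp [hu, hw, hij]
    have hww : w ⬝ᵥ w = 1 + t ^ 2 := by simp [hw, hij, hij.symm, sq]
    have key := h _ (mul_mem (reflectionMatrix_mem_orthogonalGroup hu0)
      (reflectionMatrix_mem_orthogonalGroup hw0))
    simp only [reflectionMatrix, huu, hww, sub_mul, mul_sub, one_mul, mul_one, smul_mul_assoc,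
      mul_smul_comm, vecMulVec_mul_vecMulVec, huw, trace_sub, trace_smul, trace_vecMulVec_mul,
      smul_eq_mul, one_smul] at key
    have h1 : u ⬝ᵥ S *ᵥ u = S i i := by simp [hu]
    have h2 : w ⬝ᵥ S *ᵥ w = S i i + t * (S i j + S j i) + t ^ 2 * S j j := by
      simp [hw, mulVec_add, mulVec_smul]
      ring
    have h3 : w ⬝ᵥ S *ᵥ u = S i i + t * S j i := by simp [hu, hw]
    rw [h1, h2, h3] at key
    have ht : 0 < 1 + t ^ 2 := by positivity
    field_simp at key
    nlinarith
  · rcases eq_or_ne v 0 with rfl | hv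
    · simp
    have hvv : 0 < v ⬝ᵥ v := by
      simpa using dotProduct_star_self_pos_iff.2 hv
    have key := h _ (reflectionMatrix_mem_orthogonalGroup hv)
    simp only [reflectionMatrix, sub_mul, one_mul, smul_mul_assoc, trace_sub, trace_smul,
      trace_vecMulVec_mul, smul_eq_mul] at key
    have : 0 ≤ 2 / (v ⬝ᵥ v) * (v ⬝ᵥ S *ᵥ v) := by linarith
    simpa using nonneg_of_mul_nonneg_right this (by positivity)

theorem isCompact_orthogonalGroup [DecidableEq n] :
    IsCompact (orthogonalGroup n ℝ : Set (Matrix n n ℝ)) := by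
  refine (isCompact_univ_pi fun _ : n ↦ isCompact_univ_pi fun _ : n ↦
    isCompact_closedBall (0 : ℝ) 1).of_isClosed_subset ?_ fun U hU i _ j _ ↦ ?_
  · have : (orthogonalGroup n ℝ : Set (Matrix n n ℝ)) = {U | U * Uᵀ = 1} := by
      ext U; exact mem_orthogonalGroup_iff n ℝ
    rw [this]
    exact isClosed_eq (by fun_prop) continuous_const
  · simpa using entry_norm_bound_of_unitary hU i j

/-- Left polar decomposition of a real square matrix. -/
theorem exists_orthogonal_mul_posSemidef [DecidableEq n] (M : Matrix n n ℝ) :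
    ∃ Q ∈ orthogonalGroup n ℝ, (Q * M).PosSemidef := by
  obtain ⟨Q, hQ, hmax⟩ := isCompact_orthogonalGroup.exists_isMaxOn ⟨1, one_mem _⟩
    (f := fun Q : Matrix n n ℝ ↦ (Q * M).trace) (by fun_prop)
  refine ⟨Q, hQ, posSemidef_of_forall_trace_mul_le fun R hR ↦ ?_⟩
  simpa [Matrix.mul_assoc] using hmax (mul_mem hR hQ)

theorem trace_transpose_mul_self (A : Matrix m n ℝ) :
    (Aᵀ * A).trace = ∑ j, ∑ i, A i j ^ 2 := by
  simp [trace, mul_apply, sq]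

theorem trace_sq_le_card_mul_trace_transpose_mul_self (A : Matrix n n ℝ) :
    A.trace ^ 2 ≤ Fintype.card n * (Aᵀ * A).trace := by
  rw [trace_transpose_mul_self]
  refine (sq_sum_le_card_mul_sum_sq (s := Finset.univ) (f := A.diag)).trans ?_
  rw [Finset.card_univ]
  gcongr with j
  exact Finset.single_le_sum (f := fun i ↦ A i j ^ 2) (fun i _ ↦ sq_nonneg _) (Finset.mem_univ j)

theorem trace_sub_sq_le_of_posSemidef {X Y : Matrix m n ℝ} (hXY : (X * Yᵀ).PosSemidef) :
    (((X - Y)ᵀ * (X - Y)).trace) ^ 2 ≤ 2 * Fintype.card m *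
      ((Xᵀ * X - Yᵀ * Y)ᵀ * (Xᵀ * X - Yᵀ * Y)).trace := by
  have hC : Y * Xᵀ = X * Yᵀ := by simpa [IsHermitian] using hXY.isHermitian
  set K := (X - Y) * (X - Y)ᵀ with hK
  have hKT : Kᵀ = K := by simp [hK]
  have hcs := trace_sq_le_card_mul_trace_transpose_mul_self K
  have hKC : 0 ≤ (K * (X * Yᵀ)).trace := by
    have := (hXY.conjTranspose_mul_mul_same (X - Y)).trace_nonneg
    rw [hK, Matrix.mul_assoc, trace_mul_comm]
    simpa using this
  have hPR : 0 ≤ ((X * Xᵀ - Y * Yᵀ) * (X * Xᵀ - Y * Yᵀ)).trace := by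
    have := trace_transpose_mul_self (X * Xᵀ - Y * Yᵀ)
    simp only [transpose_sub, transpose_mul, transpose_transpose] at this
    rw [this]
    positivity
  have hsum : ((Xᵀ * X - Yᵀ * Y)ᵀ * (Xᵀ * X - Yᵀ * Y)).trace = (K * K).trace / 2
      + 2 * (K * (X * Yᵀ)).trace
      + ((X * Xᵀ - Y * Yᵀ) * (X * Xᵀ - Y * Yᵀ)).trace / 2 := by
    have e1 (A B : Matrix m n ℝ) : (Aᵀ * A * (Bᵀ * B)).trace = (B * Aᵀ * (A * Bᵀ)).trace := by
      rw [← Matrix.mul_assoc, trace_mul_comm]; simp only [Matrix.mul_assoc]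
    have hK' : K = X * Xᵀ + Y * Yᵀ - X * Yᵀ - X * Yᵀ := by
      rw [hK, transpose_sub, Matrix.sub_mul, Matrix.mul_sub, Matrix.mul_sub, hC]; abel
    rw [hK']
    simp only [transpose_sub, transpose_mul, transpose_transpose, sub_mul, mul_sub, add_mul,
      mul_add, trace_sub, trace_add, e1, hC]
    rw [trace_mul_comm (X * Yᵀ) (X * Xᵀ), trace_mul_comm (X * Yᵀ) (Y * Yᵀ),
      trace_mul_comm (Y * Yᵀ) (X * Xᵀ)]
    ring
  rw [trace_mul_comm, ← hK, hsum]
  rw [hKT] at hcs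
  refine hcs.trans ?_
  have : (0 : ℝ) ≤ Fintype.card m := by positivity
  nlinarith [mul_nonneg this hKC, mul_nonneg this hPR]

/-- Orthogonal Procrustes bound in terms of the Frobenius distance of the Gram matrices. -/
theorem exists_orthogonal_trace_sub_sq_le [DecidableEq m] (X Y : Matrix m n ℝ) :
    ∃ Q : Matrix m m ℝ, Qᵀ * Q = 1 ∧
      (((Q * X - Y)ᵀ * (Q * X - Y)).trace) ^ 2 ≤ 2 * Fintype.card m *
        ((Xᵀ * X - Yᵀ * Y)ᵀ * (Xᵀ * X - Yᵀ * Y)).trace := by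
  obtain ⟨Q, hQ, hpos⟩ := exists_orthogonal_mul_posSemidef (X * Yᵀ)
  have hQ' : Qᵀ * Q = 1 := (mem_orthogonalGroup_iff' m ℝ).1 hQ
  refine ⟨Q, hQ', ?_⟩
  have hgram : (Q * X)ᵀ * (Q * X) = Xᵀ * X := by
    rw [transpose_mul, Matrix.mul_assoc, ← Matrix.mul_assoc Qᵀ, hQ', Matrix.one_mul]
  rw [← hgram]
  exact trace_sub_sq_le_of_posSemidef (by rwa [Matrix.mul_assoc])

end

/-- **Corollary (average form).** If the average squared deviation of pairwise dot products
between the columns of `X` and those of `Y` is at most `δ²`, then there is an orthogonal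
matrix `Q` such that the average squared Euclidean alignment error is at most `√(2D) δ`. -/
theorem procrustes_average_bound (D N : ℕ) (hD : 0 < D) (hN : 0 < N)
    (X Y : Matrix (Fin D) (Fin N) ℝ) (δ : ℝ) (hδ : 0 ≤ δ)
    (h : (1 / (N : ℝ) ^ 2) *
        ∑ i : Fin N, ∑ j : Fin N,
          ((∑ d : Fin D, X d i * X d j) - (∑ d : Fin D, Y d i * Y d j)) ^ 2 ≤ δ ^ 2) :
    ∃ Q : Matrix (Fin D) (Fin D) ℝ, Qᵀ * Q = 1 ∧
      (1 / (N : ℝ)) *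
        ∑ i : Fin N, ∑ d : Fin D, (Q.mulVec (fun e => X e i) d - Y d i) ^ 2 ≤
          Real.sqrt (2 * D) * δ := by
  obtain ⟨Q, hQ, hle⟩ := exists_orthogonal_trace_sub_sq_le X Y
  refine ⟨Q, hQ, ?_⟩
  have hN' : (0 : ℝ) < N := by exact_mod_cast hN
  have hG : ((Xᵀ * X - Yᵀ * Y)ᵀ * (Xᵀ * X - Yᵀ * Y)).trace ≤ (N * δ) ^ 2 := by
    rw [trace_transpose_mul_self, Finset.sum_comm]
    simp only [Matrix.sub_apply, mul_apply, transpose_apply]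
    rw [one_div, inv_mul_le_iff₀ (by positivity)] at h
    rwa [mul_pow]
  have hE : ∑ i : Fin N, ∑ d : Fin D, (Q.mulVec (fun e => X e i) d - Y d i) ^ 2 =
      ((Q * X - Y)ᵀ * (Q * X - Y)).trace := by
    rw [trace_transpose_mul_self]
    rfl
  rw [hE, one_div, inv_mul_le_iff₀ hN']
  refine abs_le_of_sq_le_sq' ?_ (by positivity) |>.2
  rw [mul_pow, mul_pow, Real.sq_sqrt (by positivity)]
  rw [Fintype.card_fin] at hle
  calc _ ≤ _ := hle
    _ ≤ 2 * D * (N * δ) ^ 2 := by gcongr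
    _ = _ := by ring
end

section
/- Let A and B be real symmetric positive semidefinite N×N matrices. Then trace((A − B)⁴) ≤ trace((A² − B²)²). -/
open Matrix

/-- The inequality in an orthonormal basis that diagonalizes `A - B`. -/
theorem trace_sub_pow_four_le_of_sub_eq_diagonal {n : Type*} [Fintype n] [DecidableEq n]
    {A B : Matrix n n ℝ} (hA : A.PosSemidef) (hB : B.PosSemidef) {d : n → ℝ}
    (h : A - B = diagonal d) :
    ((A - B) ^ 4).trace ≤ ((A ^ 2 - B ^ 2) ^ 2).trace := by
  have hM : (A ^ 2 - B ^ 2).IsHermitian := (hA.1.pow 2).sub (hB.1.pow 2)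
  have hAB : A = B + diagonal d := by rw [← h]; abel
  have hdiag (i : n) : (A ^ 2 - B ^ 2) i i = d i * (A i i + B i i) := by
    have : A ^ 2 - B ^ 2 = B * diagonal d + diagonal d * B + diagonal d * diagonal d := by
      rw [hAB]; noncomm_ring
    rw [this, hAB]
    simp [mul_diagonal, diagonal_mul]
    ring
  rw [h, diagonal_pow, trace_diagonal, pow_two (A ^ 2 - B ^ 2), trace]
  refine Finset.sum_le_sum fun i _ => ?_
  have hd : A i i = B i i + d i := by simp [hAB]
  have ha : 0 ≤ A i i := hA.diag_nonneg
  have hb : 0 ≤ B i i := hB.diag_nonneg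
  have hsq : d i ^ 2 ≤ (A i i + B i i) ^ 2 := by nlinarith [mul_nonneg ha hb]
  calc (d ^ 4) i = d i ^ 2 * d i ^ 2 := by simp only [Pi.pow_apply]; ring
    _ ≤ d i ^ 2 * (A i i + B i i) ^ 2 := by gcongr
    _ = (A ^ 2 - B ^ 2) i i * (A ^ 2 - B ^ 2) i i := by rw [hdiag]; ring
    _ ≤ ∑ j, (A ^ 2 - B ^ 2) i j * (A ^ 2 - B ^ 2) j i := by
      refine Finset.single_le_sum (f := fun j => (A ^ 2 - B ^ 2) i j * (A ^ 2 - B ^ 2) j i)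
        (fun j _ => ?_) (Finset.mem_univ i)
      have hij : (A ^ 2 - B ^ 2) j i = (A ^ 2 - B ^ 2) i j := by simpa using hM.apply i j
      rw [hij]
      exact mul_self_nonneg _
    _ = ((A ^ 2 - B ^ 2) * (A ^ 2 - B ^ 2)).diag i := by rw [diag_apply, mul_apply]

theorem trace_conjStarAlgAut {n : Type*} [Fintype n] [DecidableEq n]
    (U : unitary (Matrix n n ℝ)) (X : Matrix n n ℝ) :
    (Unitary.conjStarAlgAut ℝ _ U X).trace = X.trace := by
  rw [Unitary.conjStarAlgAut_apply, trace_mul_cycle, Unitary.coe_star_mul_self, one_mul]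

theorem Matrix.PosSemidef.conjStarAlgAut {n : Type*} [Fintype n] [DecidableEq n]
    {X : Matrix n n ℝ} (hX : X.PosSemidef) (U : unitary (Matrix n n ℝ)) :
    (Unitary.conjStarAlgAut ℝ _ U X).PosSemidef := by
  rw [Unitary.conjStarAlgAut_apply]
  exact hX.mul_mul_conjTranspose_same _

/-- **Powers–Størmer–Kittaneh inequality (p = 2, trace form).** For real symmetric
positive semidefinite matrices `A, B`, `trace((A − B)⁴) ≤ trace((A² − B²)²)`. -/
theorem powers_stormer_kittaneh_p2 (N : ℕ)
    (A B : Matrix (Fin N) (Fin N) ℝ)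
    (hA : A.PosSemidef) (hB : B.PosSemidef) :
    ((A - B) ^ 4).trace ≤ ((A ^ 2 - B ^ 2) ^ 2).trace := by
  have hD : (A - B).IsHermitian := hA.1.sub hB.1
  let U := star hD.eigenvectorUnitary
  have key := trace_sub_pow_four_le_of_sub_eq_diagonal (hA.conjStarAlgAut U)
    (hB.conjStarAlgAut U) (d := RCLike.ofReal ∘ hD.eigenvalues)
    (by rw [← map_sub]; exact hD.conjStarAlgAut_star_eigenvectorUnitary)
  simpa only [← map_sub, ← map_pow, trace_conjStarAlgAut] using key
end

section
/- Let X, Y be real D×N matrices and suppose Y Xᵀ = U Σ Vᵀ, where U and V are D×D orthogonal matrices and Σ is a D×D diagonal matrix with nonnegative diagonal entries. Then the orthogonal matrix Q⋆ = U Vᵀ satisfies ‖Q⋆ X − Y‖_F ≤ ‖Q X − Y‖_F for every D×D orthogonal matrix Q. -/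
open Matrix

lemma sum_sq_entries_eq_trace {m n : Type*} [Fintype m] [Fintype n] (A : Matrix m n ℝ) :
    ∑ i, ∑ j, (A i j) ^ 2 = (Aᵀ * A).trace := by
  rw [Finset.sum_comm]
  simp [Matrix.trace, Matrix.mul_apply, sq]

/-- For orthogonal `Q`, the norm `‖QX - Y‖_F` depends on `Q` only through `tr (Y Xᵀ Qᵀ)`. -/
lemma frobNorm_orthogonal_mul_sub {m n : Type*} [Fintype m] [DecidableEq m] [Fintype n]
    {Q : Matrix m m ℝ} (hQ : Qᵀ * Q = 1) (X Y : Matrix m n ℝ) :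
    frobNorm (Q * X - Y) =
      Real.sqrt ((Xᵀ * X).trace + (Yᵀ * Y).trace - 2 * (Y * Xᵀ * Qᵀ).trace) := by
  have hXX : (Q * X)ᵀ * (Q * X) = Xᵀ * X := by
    rw [transpose_mul, Matrix.mul_assoc, ← Matrix.mul_assoc Qᵀ, hQ, Matrix.one_mul]
  have hXY : ((Q * X)ᵀ * Y).trace = (Y * Xᵀ * Qᵀ).trace := by
    rw [trace_mul_comm, transpose_mul, Matrix.mul_assoc]
  have hYX : (Yᵀ * (Q * X)).trace = (Y * Xᵀ * Qᵀ).trace := by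
    rw [← hXY, ← trace_transpose, transpose_mul, transpose_transpose]
  rw [frobNorm, sum_sq_entries_eq_trace]
  congr 1
  rw [transpose_sub, Matrix.sub_mul, Matrix.mul_sub, Matrix.mul_sub]
  simp only [trace_sub, hXX, hXY, hYX]
  ring

lemma trace_mul_le_trace_of_orthogonal {n : Type*} [Fintype n] [DecidableEq n]
    {S W : Matrix n n ℝ} (hS : S.IsDiag) (hS0 : ∀ i, 0 ≤ S i i) (hW : Wᵀ * W = 1) :
    (S * W).trace ≤ S.trace := by
  have hWmem : W ∈ unitaryGroup n ℝ := by
    rw [mem_unitaryGroup_iff', star_eq_conjTranspose, conjTranspose_eq_transpose_of_trivial, hW]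
  rw [← hS.diagonal_diag]
  simp only [Matrix.trace, diag_apply, diagonal_mul, diagonal_apply_eq]
  refine Finset.sum_le_sum fun i _ => mul_le_of_le_one_right (hS0 i) ?_
  exact (le_abs_self _).trans (entry_norm_bound_of_unitary hWmem i i)

/-- **Schönemann's solution to the orthogonal Procrustes problem.** If `Y Xᵀ = U S Vᵀ`
is a singular value decomposition (with `U, V` orthogonal and `S` diagonal with
nonnegative entries), then `Q⋆ = U Vᵀ` minimizes `‖QX − Y‖_F` over orthogonal `Q`. -/
theorem schonemann_orthogonal_procrustes (D N : ℕ)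
    (X Y : Matrix (Fin D) (Fin N) ℝ)
    (U V S : Matrix (Fin D) (Fin D) ℝ)
    (hU : Uᵀ * U = 1) (hV : Vᵀ * V = 1)
    (hSdiag : S.IsDiag) (hSnonneg : ∀ i : Fin D, 0 ≤ S i i)
    (hSVD : Y * Xᵀ = U * S * Vᵀ) :
    ∀ Q : Matrix (Fin D) (Fin D) ℝ, Qᵀ * Q = 1 →
      frobNorm (U * Vᵀ * X - Y) ≤ frobNorm (Q * X - Y) := by
  intro Q hQ
  have hQ' : Q * Qᵀ = 1 := mul_eq_one_comm.mp hQ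
  have hUV : (U * Vᵀ)ᵀ * (U * Vᵀ) = 1 := by
    rw [transpose_mul, transpose_transpose, Matrix.mul_assoc, ← Matrix.mul_assoc Uᵀ, hU,
      Matrix.one_mul, mul_eq_one_comm.mp hV]
  have hW : (Vᵀ * Qᵀ * U)ᵀ * (Vᵀ * Qᵀ * U) = 1 := by
    calc (Vᵀ * Qᵀ * U)ᵀ * (Vᵀ * Qᵀ * U) = Uᵀ * (Q * (V * Vᵀ) * Qᵀ) * U := by
          simp only [transpose_mul, transpose_transpose, Matrix.mul_assoc]
      _ = 1 := by rw [mul_eq_one_comm.mp hV, Matrix.mul_one, hQ', Matrix.mul_one, hU]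
  have hstar : (Y * Xᵀ * (U * Vᵀ)ᵀ).trace = S.trace := by
    calc (Y * Xᵀ * (U * Vᵀ)ᵀ).trace = (U * (S * (Vᵀ * V) * Uᵀ)).trace := by
          simp only [hSVD, transpose_mul, transpose_transpose, Matrix.mul_assoc]
      _ = S.trace := by
          rw [hV, Matrix.mul_one, trace_mul_comm, Matrix.mul_assoc, hU, Matrix.mul_one]
  have htrace : (Y * Xᵀ * Qᵀ).trace = (S * (Vᵀ * Qᵀ * U)).trace := by
    rw [hSVD, Matrix.mul_assoc, Matrix.mul_assoc, trace_mul_comm]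
    simp only [Matrix.mul_assoc]
  rw [frobNorm_orthogonal_mul_sub hUV, frobNorm_orthogonal_mul_sub hQ, hstar, htrace]
  refine Real.sqrt_le_sqrt ?_
  linarith [trace_mul_le_trace_of_orthogonal hSdiag hSnonneg hW]
end

section
/- Let D be a positive integer, ε > 0, and c = √(ε / (2√(2D))). Define real D×(2D) matrices X and Y by their columns: for i = 1,…,D, x_{2i−1} = x_{2i} = c·eᵢ, y_{2i−1} = c·eᵢ, and y_{2i} = −c·eᵢ, where eᵢ is the i-th standard basis vector of ℝ^D. Then ‖XᵀX − YᵀY‖_F = ε, and for every D×D orthogonal matrix Q, ‖QX − Y‖_F = (2D)^{1/4} · √ε. In particular the bound of the main theorem (min over orthogonal Q of ‖QX − Y‖_F ≤ (2D)^{1/4}√ε whenever ‖XᵀX − YᵀY‖_F ≤ ε) is attained with equality. -/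
open Matrix

/-- A sum over `Fin (2 * D)` split into consecutive pairs of even and odd indices. -/
theorem sum_fin_two_mul {M : Type*} [AddCommMonoid M] {D : ℕ} (f : Fin (2 * D) → M) :
    ∑ j, f j = ∑ i : Fin D, (f ⟨2 * i, by lia⟩ + f ⟨2 * i + 1, by lia⟩) := by
  rw [← (finProdFinEquiv.trans (finCongr (mul_comm D 2))).sum_comp f, Fintype.sum_prod_type]
  refine Finset.sum_congr rfl fun i _ => ?_
  rw [Fin.sum_univ_two]
  congr 2 <;> (ext; simp [finProdFinEquiv, add_comm])

/-- The squared entries of a matrix with orthonormal columns sum to the number of columns. -/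
theorem sum_sq_of_transpose_mul_self_eq_one {m n : Type*} [Fintype m] [Fintype n] [DecidableEq n]
    {Q : Matrix m n ℝ} (hQ : Qᵀ * Q = 1) : ∑ d, ∑ i, Q d i ^ 2 = Fintype.card n := by
  rw [Finset.sum_comm]
  have h (i : n) : ∑ d, Q d i ^ 2 = 1 := by
    simpa [Matrix.mul_apply, sq] using congrFun (congrFun hQ i) i
  simp [h]

/-- **Tightness of the upper bound.**  With `c = √(ε / (2√(2D)))`, let `X` have columns
`x_{2i−1} = x_{2i} = c eᵢ` and `Y` have columns `y_{2i−1} = c eᵢ`, `y_{2i} = −c eᵢ`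
(for `i = 1,…,D`; here columns are indexed by `j : Fin (2D)`, with `x_j, y_j` supported
on row `⌊j/2⌋`, and `y_j` carries the sign `(−1)^{j mod 2}`).  Then
`‖XᵀX − YᵀY‖_F = ε` and `‖QX − Y‖_F = (2D)^{1/4} √ε` for every orthogonal `Q`. -/
theorem procrustes_bound_tight (D : ℕ) (hD : 0 < D) (ε : ℝ) (hε : 0 < ε)
    (c : ℝ) (hc : c = Real.sqrt (ε / (2 * Real.sqrt (2 * D))))
    (X Y : Matrix (Fin D) (Fin (2 * D)) ℝ)
    (hX : ∀ (d : Fin D) (j : Fin (2 * D)),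
      X d j = if (j : ℕ) / 2 = (d : ℕ) then c else 0)
    (hY : ∀ (d : Fin D) (j : Fin (2 * D)),
      Y d j = if (j : ℕ) / 2 = (d : ℕ) then (if (j : ℕ) % 2 = 0 then c else -c) else 0) :
    frobNorm (Xᵀ * X - Yᵀ * Y) = ε ∧
    ∀ Q : Matrix (Fin D) (Fin D) ℝ, Qᵀ * Q = 1 →
      frobNorm (Q * X - Y) = ((2 * D : ℝ)) ^ ((1 : ℝ) / 4) * Real.sqrt ε := by
  have hD' : (0 : ℝ) < 2 * D := by positivity
  have hs : 0 < Real.sqrt (2 * D) := Real.sqrt_pos.2 hD'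
  have hss : Real.sqrt (2 * D) ^ 2 = 2 * D := Real.sq_sqrt hD'.le
  have hc2 : c ^ 2 = ε / (2 * Real.sqrt (2 * D)) := by
    rw [hc, Real.sq_sqrt (by positivity)]
  have odd_div (i : ℕ) : (2 * i + 1) / 2 = i := by lia
  have odd_mod (i : ℕ) : (2 * i + 1) % 2 = 1 := by lia
  refine ⟨?_, fun Q hQ => ?_⟩
  · have hgram (j k : Fin (2 * D)) : (Xᵀ * X - Yᵀ * Y) j k =
        if (j : ℕ) / 2 = k / 2 then (if (j : ℕ) % 2 = k % 2 then 0 else 2 * c ^ 2) else 0 := by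
      rw [Matrix.sub_apply, Matrix.mul_apply, Matrix.mul_apply,
        Finset.sum_eq_single ⟨j / 2, by lia⟩, Finset.sum_eq_single ⟨j / 2, by lia⟩]
      · simp only [Matrix.transpose_apply, hX, hY, if_true, eq_comm (a := (k : ℕ) / 2)]
        split_ifs <;> first | (exfalso; lia) | ring
      · intro b _ hb
        rw [Matrix.transpose_apply, hY, if_neg fun h => hb (Fin.ext h.symm), zero_mul]
      · simp
      · intro b _ hb
        rw [Matrix.transpose_apply, hX, if_neg fun h => hb (Fin.ext h.symm), zero_mul]
      · simp
    have hsum : ∑ j, ∑ k, (Xᵀ * X - Yᵀ * Y) j k ^ 2 = 8 * D * (c ^ 2) ^ 2 := by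
      simp only [sum_fin_two_mul, hgram, odd_div, odd_mod, Nat.mul_div_cancel_left _ two_pos,
        Nat.mul_mod_right, Fin.val_inj, ite_pow, if_true, one_ne_zero, zero_ne_one, if_false,
        ne_eq, OfNat.ofNat_ne_zero, not_false_eq_true, zero_pow, ite_self, zero_add, add_zero,
        Finset.sum_ite_eq, Finset.mem_univ, Finset.sum_const, Finset.card_univ, Fintype.card_fin,
        nsmul_eq_mul]
      ring
    rw [frobNorm, hsum, hc2, ← Real.sqrt_sq hε.le]
    congr 1
    rw [Real.sqrt_sq hε.le, div_pow, mul_pow, hss]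
    field_simp
    norm_num
  · have hQX (d : Fin D) (j : Fin (2 * D)) :
        (Q * X) d j = Q d ⟨j / 2, by lia⟩ * c := by
      rw [Matrix.mul_apply, Finset.sum_eq_single ⟨j / 2, by lia⟩]
      · simp [hX]
      · intro b _ hb
        rw [hX, if_neg fun h => hb (Fin.ext h.symm), mul_zero]
      · simp
    have hpair (d i : Fin D) :
        (Q * X - Y) d ⟨2 * i, by lia⟩ ^ 2 + (Q * X - Y) d ⟨2 * i + 1, by lia⟩ ^ 2 =
          2 * c ^ 2 * (Q d i ^ 2 + if i = d then 1 else 0) := by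
      simp only [Matrix.sub_apply, hQX, hY, odd_div, odd_mod,
        Nat.mul_div_cancel_left _ two_pos, Nat.mul_mod_right, Fin.val_inj,
        one_ne_zero, if_true, if_false]
      split_ifs <;> ring
    have hsum : ∑ d, ∑ j, (Q * X - Y) d j ^ 2 = Real.sqrt (2 * D) * ε := by
      simp only [sum_fin_two_mul, hpair, ← Finset.mul_sum, Finset.sum_add_distrib,
        sum_sq_of_transpose_mul_self_eq_one hQ]
      simp only [Finset.sum_ite_eq', Finset.mem_univ, if_true, Finset.sum_const,
        Finset.card_univ, Fintype.card_fin, nsmul_eq_mul, mul_one, hc2]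
      field_simp
      rw [hss]
      ring
    rw [frobNorm, hsum, Real.sqrt_mul hs.le, Real.sqrt_eq_rpow (2 * D : ℝ),
      Real.sqrt_eq_rpow ((2 * D : ℝ) ^ (1 / 2 : ℝ)), ← Real.rpow_mul hD'.le]
    norm_num
end
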